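/- If V ∈ Ĉ(D) is a viscosity solution of the HJB equation satisfying (S1) and (S2), then V(t,r,x) ≤ N̂[V](t,r,x) for all (t,r,x) ∈ [0,T]×[0,T]×ℝⁿ. -/

import Mathlib

open Set Matrix

open scoped RealInnerProductSpace

/-- Frobenius norm of a real matrix. -/
noncomputable def frobNorm (n d : ℕ) (A : Matrix (Fin n) (Fin d) ℝ) : ℝ :=
  Real.sqrt (∑ i, ∑ j, (A i j) ^ 2)

/-- The Hamiltonian `H(t,x,p,P) = ⟨b(t,x),p⟩ + (1/2) tr(σ(t,x)ᵀ P σ(t,x)) + g(t,x)`. -/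
noncomputable def Ham (n d : ℕ)
    (b : ℝ → EuclideanSpace ℝ (Fin n) → EuclideanSpace ℝ (Fin n))
    (σ : ℝ → EuclideanSpace ℝ (Fin n) → Matrix (Fin n) (Fin d) ℝ)
    (g : ℝ → EuclideanSpace ℝ (Fin n) → ℝ)
    (t : ℝ) (x p : EuclideanSpace ℝ (Fin n)) (P : Matrix (Fin n) (Fin n) ℝ) : ℝ :=
  ⟪b t x, p⟫ + (1/2) * ((σ t x)ᵀ * P * σ t x).trace + g t x

/-- The intervention operator `N[V](t,0,x) = inf_{ξ ∈ K} [V(t,0,x+ξ) + ℓ(t,ξ)]`. -/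
noncomputable def Nop (n : ℕ) (K : Set (EuclideanSpace ℝ (Fin n)))
    (ℓ : ℝ → EuclideanSpace ℝ (Fin n) → ℝ)
    (V : ℝ → ℝ → EuclideanSpace ℝ (Fin n) → ℝ)
    (t : ℝ) (x : EuclideanSpace ℝ (Fin n)) : ℝ :=
  sInf {y : ℝ | ∃ ξ ∈ K, y = V t 0 (x + ξ) + ℓ t ξ}

/-- The modified obstacle `N̂[V](t,r,x)`: equals `N[V](t,0,x)` for `r ≥ δ` and
`2L(T+1)` for `r < δ`. -/
noncomputable def Nhat (n : ℕ) (T δ L : ℝ) (K : Set (EuclideanSpace ℝ (Fin n)))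
    (ℓ : ℝ → EuclideanSpace ℝ (Fin n) → ℝ)
    (V : ℝ → ℝ → EuclideanSpace ℝ (Fin n) → ℝ)
    (t r : ℝ) (x : EuclideanSpace ℝ (Fin n)) : ℝ :=
  if δ ≤ r then Nop n K ℓ V t x else 2 * L * (T + 1)

/-- The domain `D = [0,T] × [0,T] × ℝⁿ`. -/
def Dom (n : ℕ) (T : ℝ) : Set (ℝ × ℝ × EuclideanSpace ℝ (Fin n)) :=
  Icc 0 T ×ˢ Icc 0 T ×ˢ univ

/-- The terminal value `min{h(x), inf_{ξ∈K}[h(x+ξ) + ℓ(T,ξ)]}`. -/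
noncomputable def termVal (n : ℕ) (T : ℝ) (K : Set (EuclideanSpace ℝ (Fin n)))
    (h : EuclideanSpace ℝ (Fin n) → ℝ) (ℓ : ℝ → EuclideanSpace ℝ (Fin n) → ℝ)
    (x : EuclideanSpace ℝ (Fin n)) : ℝ :=
  min (h x) (sInf {y : ℝ | ∃ ξ ∈ K, y = h (x + ξ) + ℓ T ξ})

/-- A test function: continuous on `D`, `C¹` in `(t,r)`, `C²` in `x`, and constant in
`r` on `[δ,T]`, with its partial derivatives `φt, φr`, gradient `φx` and Hessian `φxx`
bundled. -/
structure TestFn (n : ℕ) (T δ : ℝ) where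
  φ : ℝ → ℝ → EuclideanSpace ℝ (Fin n) → ℝ
  φt : ℝ → ℝ → EuclideanSpace ℝ (Fin n) → ℝ
  φr : ℝ → ℝ → EuclideanSpace ℝ (Fin n) → ℝ
  φx : ℝ → ℝ → EuclideanSpace ℝ (Fin n) → EuclideanSpace ℝ (Fin n)
  φxx : ℝ → ℝ → EuclideanSpace ℝ (Fin n) → Matrix (Fin n) (Fin n) ℝ
  cont : Continuous fun p : ℝ × ℝ × EuclideanSpace ℝ (Fin n) => φ p.1 p.2.1 p.2.2
  hasφt : ∀ t r x, HasDerivAt (fun s => φ s r x) (φt t r x) t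
  hasφr : ∀ t r x, HasDerivAt (fun s => φ t s x) (φr t r x) r
  hasφx : ∀ t r x, HasGradientAt (fun y => φ t r y) (φx t r x) x
  hasφxx : ∀ t r x, HasFDerivAt (fun y => φx t r y)
      (LinearMap.toContinuousLinearMap (Matrix.toEuclideanLin (φxx t r x))) x
  contφt : Continuous fun p : ℝ × ℝ × EuclideanSpace ℝ (Fin n) => φt p.1 p.2.1 p.2.2
  contφr : Continuous fun p : ℝ × ℝ × EuclideanSpace ℝ (Fin n) => φr p.1 p.2.1 p.2.2
  contφx : Continuous fun p : ℝ × ℝ × EuclideanSpace ℝ (Fin n) => φx p.1 p.2.1 p.2.2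
  contφxx : Continuous fun p : ℝ × ℝ × EuclideanSpace ℝ (Fin n) => φxx p.1 p.2.1 p.2.2
  symm : ∀ t r x, (φxx t r x).IsSymm
  flat : ∀ t r x, δ ≤ r → φ t r x = φ t δ x

/-- Membership in the class `Ĉ(D)`: continuous on `D`, bounded above by `L(T+1)`, and
constant in `r` on `[δ,T]`. -/
def InCHat (n : ℕ) (T δ L : ℝ) (V : ℝ → ℝ → EuclideanSpace ℝ (Fin n) → ℝ) : Prop :=
  ContinuousOn (fun p : ℝ × ℝ × EuclideanSpace ℝ (Fin n) => V p.1 p.2.1 p.2.2)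
      (Dom n T) ∧
  (∀ t ∈ Icc (0:ℝ) T, ∀ r ∈ Icc (0:ℝ) T, ∀ x, V t r x ≤ L * (T + 1)) ∧
  (∀ t r x, δ ≤ r → r ≤ T → V t r x = V t δ x)

/-- Condition (S1): `|V| ≤ L(T+1)` on `D`. -/
def CondS1 (n : ℕ) (T L : ℝ) (V : ℝ → ℝ → EuclideanSpace ℝ (Fin n) → ℝ) : Prop :=
  ∀ t ∈ Icc (0:ℝ) T, ∀ r ∈ Icc (0:ℝ) T, ∀ x, |V t r x| ≤ L * (T + 1)

/-- Condition (S2): a Hölder-Lipschitz modulus of continuity on `D` (with `r` entering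
through `min(r,δ)`). -/
def CondS2 (n : ℕ) (T δ : ℝ) (V : ℝ → ℝ → EuclideanSpace ℝ (Fin n) → ℝ) : Prop :=
  ∃ C > 0, ∀ t ∈ Icc (0:ℝ) T, ∀ r ∈ Icc (0:ℝ) T, ∀ x : EuclideanSpace ℝ (Fin n),
    ∀ th ∈ Icc (0:ℝ) T, ∀ rh ∈ Icc (0:ℝ) T, ∀ xh : EuclideanSpace ℝ (Fin n),
    |V t r x - V th rh xh|
      ≤ C * (Real.sqrt |t - th| + Real.sqrt |min r δ - min rh δ| + ‖x - xh‖)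

/-- Viscosity subsolution of the HJB equation (HJB3). -/
def IsSubsol (n d : ℕ) (T δ L : ℝ) (K : Set (EuclideanSpace ℝ (Fin n)))
    (b : ℝ → EuclideanSpace ℝ (Fin n) → EuclideanSpace ℝ (Fin n))
    (σ : ℝ → EuclideanSpace ℝ (Fin n) → Matrix (Fin n) (Fin d) ℝ)
    (g : ℝ → EuclideanSpace ℝ (Fin n) → ℝ)
    (h : EuclideanSpace ℝ (Fin n) → ℝ)
    (ℓ : ℝ → EuclideanSpace ℝ (Fin n) → ℝ)
    (V : ℝ → ℝ → EuclideanSpace ℝ (Fin n) → ℝ) : Prop :=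
  (∀ r ∈ Icc (0:ℝ) T, ∀ x, V T r x ≤ termVal n T K h ℓ x) ∧
  (∀ ψ : TestFn n T δ, ∀ t₀ ∈ Ico (0:ℝ) T, ∀ r₀ ∈ Ico (0:ℝ) T,
    ∀ x₀ : EuclideanSpace ℝ (Fin n),
    IsLocalMaxOn
      (fun p : ℝ × ℝ × EuclideanSpace ℝ (Fin n) =>
        V p.1 p.2.1 p.2.2 - ψ.φ p.1 p.2.1 p.2.2)
      (Dom n T) (t₀, r₀, x₀) →
    0 ≤ min
      (ψ.φt t₀ r₀ x₀ + ψ.φr t₀ r₀ x₀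
        + Ham n d b σ g t₀ x₀ (ψ.φx t₀ r₀ x₀) (ψ.φxx t₀ r₀ x₀))
      (Nhat n T δ L K ℓ V t₀ r₀ x₀ - V t₀ r₀ x₀))

/-- Viscosity supersolution of the HJB equation (HJB3). -/
def IsSupersol (n d : ℕ) (T δ L : ℝ) (K : Set (EuclideanSpace ℝ (Fin n)))
    (b : ℝ → EuclideanSpace ℝ (Fin n) → EuclideanSpace ℝ (Fin n))
    (σ : ℝ → EuclideanSpace ℝ (Fin n) → Matrix (Fin n) (Fin d) ℝ)
    (g : ℝ → EuclideanSpace ℝ (Fin n) → ℝ)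
    (h : EuclideanSpace ℝ (Fin n) → ℝ)
    (ℓ : ℝ → EuclideanSpace ℝ (Fin n) → ℝ)
    (V : ℝ → ℝ → EuclideanSpace ℝ (Fin n) → ℝ) : Prop :=
  (∀ r ∈ Icc (0:ℝ) T, ∀ x, termVal n T K h ℓ x ≤ V T r x) ∧
  (∀ ψ : TestFn n T δ, ∀ t₀ ∈ Ico (0:ℝ) T, ∀ r₀ ∈ Ico (0:ℝ) T,
    ∀ x₀ : EuclideanSpace ℝ (Fin n),
    IsLocalMinOn
      (fun p : ℝ × ℝ × EuclideanSpace ℝ (Fin n) =>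
        V p.1 p.2.1 p.2.2 - ψ.φ p.1 p.2.1 p.2.2)
      (Dom n T) (t₀, r₀, x₀) →
    min
      (ψ.φt t₀ r₀ x₀ + ψ.φr t₀ r₀ x₀
        + Ham n d b σ g t₀ x₀ (ψ.φx t₀ r₀ x₀) (ψ.φxx t₀ r₀ x₀))
      (Nhat n T δ L K ℓ V t₀ r₀ x₀ - V t₀ r₀ x₀) ≤ 0)

/-- The quadratic test function `k((t-a)² + |x-y|²)`. -/
noncomputable def quadTest (n : ℕ) (T δ k a : ℝ) (y : EuclideanSpace ℝ (Fin n)) :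
    TestFn n T δ where
  φ t _ x := k * ((t - a) ^ 2 + ‖x - y‖ ^ 2)
  φt t _ _ := k * (2 * (t - a))
  φr _ _ _ := 0
  φx _ _ x := (2 * k) • (x - y)
  φxx _ _ _ := (2 * k) • (1 : Matrix (Fin n) (Fin n) ℝ)
  cont := by fun_prop
  hasφt t r x := by
    have h1 : HasDerivAt (fun s : ℝ => (s - a) ^ 2) (2 * (t - a)) t := by
      have h0 := ((hasDerivAt_id t).sub_const a).fun_pow 2
      simpa using h0
    exact (h1.add_const _).const_mul k
  hasφr t r x := hasDerivAt_const _ _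
  hasφx t r x := by
    rw [hasGradientAt_iff_hasFDerivAt]
    have h1 : HasFDerivAt (fun z : EuclideanSpace ℝ (Fin n) => z - y)
        (ContinuousLinearMap.id ℝ (EuclideanSpace ℝ (Fin n))) x :=
      (hasFDerivAt_id x).sub_const y
    have h2 := ((h1.norm_sq).const_add ((t - a) ^ 2)).const_mul k
    refine h2.congr_fderiv ?_
    ext z
    simp [inner_smul_left]
    ring
  hasφxx t r x := by
    have h1 : HasFDerivAt (fun z : EuclideanSpace ℝ (Fin n) => z - y)
        (ContinuousLinearMap.id ℝ (EuclideanSpace ℝ (Fin n))) x :=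
      (hasFDerivAt_id x).sub_const y
    refine (h1.const_smul (2 * k)).congr_fderiv ?_
    ext z i
    simp [Matrix.toLpLin_apply, Matrix.smul_mulVec]
  contφt := by fun_prop
  contφr := by fun_prop
  contφx := by fun_prop
  contφxx := by fun_prop
  symm t r x := by
    simp [Matrix.IsSymm]
  flat t r x _ := rfl

/-- A viscosity solution of the HJB equation satisfying (S1)-(S2)
lies below the obstacle: `V ≤ N̂[V]` on `[0,T] × [0,T] × ℝⁿ`. -/
theorem stmt_12
    (n d : ℕ) (hn : 1 ≤ n) (hd : 1 ≤ d) (T δ L ℓ₀ α : ℝ)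
    (hT : 0 < T) (hδ : 0 < δ) (hδT : δ < T) (hL : 0 < L)
    (hℓ₀ : 0 < ℓ₀) (hα : 0 < α)
    (K : Set (EuclideanSpace ℝ (Fin n))) (hKne : K.Nonempty) (hKcl : IsClosed K)
    (hKconv : Convex ℝ K) (hKcone : ∀ c : ℝ, 0 ≤ c → ∀ x ∈ K, c • x ∈ K)
    (b : ℝ → EuclideanSpace ℝ (Fin n) → EuclideanSpace ℝ (Fin n))
    (σ : ℝ → EuclideanSpace ℝ (Fin n) → Matrix (Fin n) (Fin d) ℝ)
    (g : ℝ → EuclideanSpace ℝ (Fin n) → ℝ)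
    (h : EuclideanSpace ℝ (Fin n) → ℝ)
    (ℓ : ℝ → EuclideanSpace ℝ (Fin n) → ℝ)
    (hbcont : ContinuousOn (fun p : ℝ × EuclideanSpace ℝ (Fin n) => b p.1 p.2)
      (Icc (0:ℝ) T ×ˢ (univ : Set (EuclideanSpace ℝ (Fin n)))))
    (hσcont : ContinuousOn (fun p : ℝ × EuclideanSpace ℝ (Fin n) => σ p.1 p.2)
      (Icc (0:ℝ) T ×ˢ (univ : Set (EuclideanSpace ℝ (Fin n)))))
    (hgcont : ContinuousOn (fun p : ℝ × EuclideanSpace ℝ (Fin n) => g p.1 p.2)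
      (Icc (0:ℝ) T ×ˢ (univ : Set (EuclideanSpace ℝ (Fin n)))))
    (hhcont : Continuous h)
    (hℓcont : ContinuousOn (fun p : ℝ × EuclideanSpace ℝ (Fin n) => ℓ p.1 p.2)
      (Icc (0:ℝ) T ×ˢ K))
    (hH1lip : ∀ t ∈ Icc (0:ℝ) T, ∀ x xh : EuclideanSpace ℝ (Fin n),
      ‖b t x - b t xh‖ + frobNorm n d (σ t x - σ t xh) ≤ L * ‖x - xh‖)
    (hH1bdd : ∀ t ∈ Icc (0:ℝ) T, ∀ x : EuclideanSpace ℝ (Fin n),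
      ‖b t x‖ + frobNorm n d (σ t x) ≤ L)
    (hH2lip : ∀ t ∈ Icc (0:ℝ) T, ∀ x xh : EuclideanSpace ℝ (Fin n),
      |g t x - g t xh| + |h x - h xh| ≤ L * ‖x - xh‖)
    (hH2bdd : ∀ t ∈ Icc (0:ℝ) T, ∀ x : EuclideanSpace ℝ (Fin n), |g t x| + |h x| ≤ L)
    (hℓpos : ∀ t ∈ Icc (0:ℝ) T, ∀ ξ ∈ K, 0 < ℓ t ξ)
    (hℓsubadd : ∀ t ∈ Icc (0:ℝ) T, ∀ ξ ∈ K, ∀ ξh ∈ K, ℓ t (ξ + ξh) < ℓ t ξ + ℓ t ξh)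
    (hℓmono : ∀ t ∈ Icc (0:ℝ) T, ∀ th ∈ Icc (0:ℝ) T, t ≤ th → ∀ ξ ∈ K, ℓ th ξ ≤ ℓ t ξ)
    (hℓcoer : ∀ t ∈ Icc (0:ℝ) T, ∀ ξ ∈ K, ℓ₀ + α * ‖ξ‖ ≤ ℓ t ξ)
    (V : ℝ → ℝ → EuclideanSpace ℝ (Fin n) → ℝ)
    (hVC : InCHat n T δ L V)
    (hsub : IsSubsol n d T δ L K b σ g h ℓ V)
    (hsuper : IsSupersol n d T δ L K b σ g h ℓ V)
    (hS1 : CondS1 n T L V) (hS2 : CondS2 n T δ V) :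
    ∀ t ∈ Icc (0:ℝ) T, ∀ r ∈ Icc (0:ℝ) T, ∀ x : EuclideanSpace ℝ (Fin n),
      V t r x ≤ Nhat n T δ L K ℓ V t r x := by
  obtain ⟨hVcont, hVle, hVflat⟩ := hVC
  have hM : 0 < L * (T + 1) := by positivity
  set M := L * (T + 1) with hMdef
  have hδI : δ ∈ Icc (0:ℝ) T := ⟨hδ.le, hδT.le⟩
  have h0I : (0:ℝ) ∈ Icc (0:ℝ) T := ⟨le_rfl, hT.le⟩
  have hbdd : ∀ t ∈ Icc (0:ℝ) T, ∀ x : EuclideanSpace ℝ (Fin n),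
      BddBelow {y : ℝ | ∃ ξ ∈ K, y = V t 0 (x + ξ) + ℓ t ξ} := by
    intro t ht x
    refine ⟨-M, ?_⟩
    rintro y ⟨ξ, hξ, rfl⟩
    have h1 := (abs_le.1 (hS1 t ht 0 h0I (x + ξ))).1
    have h2 := hℓpos t ht ξ hξ
    linarith
  have hcδ : ContinuousOn (fun p : ℝ × EuclideanSpace ℝ (Fin n) => V p.1 δ p.2)
      (Icc (0:ℝ) T ×ˢ univ) := by
    refine hVcont.comp (f := fun p : ℝ × EuclideanSpace ℝ (Fin n) => (p.1, δ, p.2))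
      (by fun_prop) ?_
    rintro ⟨t, x⟩ ⟨ht, -⟩
    exact ⟨ht, hδI, mem_univ _⟩
  -- near every point with `t < T` there are points where the obstacle inequality holds
  have key : ∀ a ∈ Ico (0:ℝ) T, ∀ y : EuclideanSpace ℝ (Fin n), ∀ ε > 0,
      ∃ t ∈ Icc (0:ℝ) T, ∃ x, |t - a| < ε ∧ ‖x - y‖ < ε ∧
        V t δ x ≤ Nop n K ℓ V t x := by
    intro a ha y ε' hε'
    obtain ⟨ε, hε, hεε', hεT⟩ : ∃ ε > 0, ε ≤ ε' ∧ a + ε < T := by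
      refine ⟨min ε' ((T - a) / 2), lt_min hε' (by linarith [ha.2]), min_le_left _ _, ?_⟩
      linarith [min_le_right ε' ((T - a) / 2), ha.2]
    have haI : a ∈ Icc (0:ℝ) T := ⟨ha.1, ha.2.le⟩
    set k : ℝ := 3 * M / ε ^ 2 with hk
    have hkε : k * ε ^ 2 = 3 * M := by rw [hk]; field_simp
    have hkpos : 0 < k := by positivity
    set S : Set (ℝ × EuclideanSpace ℝ (Fin n)) :=
      (Icc (0:ℝ) T ∩ Metric.closedBall a ε) ×ˢ Metric.closedBall y ε with hS
    have hScomp : IsCompact S :=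
      (isCompact_Icc.inter_right Metric.isClosed_closedBall).prod (isCompact_closedBall y ε)
    have hSa : (a, y) ∈ S :=
      ⟨⟨haI, Metric.mem_closedBall_self hε.le⟩, Metric.mem_closedBall_self hε.le⟩
    have hfc : ContinuousOn (fun p : ℝ × EuclideanSpace ℝ (Fin n) =>
        V p.1 δ p.2 - k * ((p.1 - a) ^ 2 + ‖p.2 - y‖ ^ 2)) S := by
      refine ContinuousOn.sub (hcδ.mono ?_) (by fun_prop)
      rintro ⟨t, x⟩ ⟨⟨ht, -⟩, -⟩
      exact ⟨ht, mem_univ _⟩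
    obtain ⟨⟨t, x⟩, ⟨⟨ht, hta⟩, hxy⟩, hmax⟩ := hScomp.exists_isMaxOn ⟨_, hSa⟩ hfc
    have hmax' : ∀ s z, s ∈ Icc (0:ℝ) T → |s - a| ≤ ε → ‖z - y‖ ≤ ε →
        V s δ z - k * ((s - a) ^ 2 + ‖z - y‖ ^ 2)
          ≤ V t δ x - k * ((t - a) ^ 2 + ‖x - y‖ ^ 2) := by
      intro s z hs h1 h2
      exact hmax (a := (s, z)) ⟨⟨hs, by simpa [Real.dist_eq] using h1⟩,
        by simpa [dist_eq_norm] using h2⟩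
    have h1 := hmax' a y haI (by simpa using hε.le) (by simpa using hε.le)
    have h2 := (abs_le.1 (hS1 a haI δ hδI y)).1
    have h3 := hVle t ht δ hδI x
    simp only [sub_self, norm_zero] at h1
    have h4 : k * ((t - a) ^ 2 + ‖x - y‖ ^ 2) < k * ε ^ 2 := by rw [hkε]; linarith
    have h5 : (t - a) ^ 2 + ‖x - y‖ ^ 2 < ε ^ 2 := lt_of_mul_lt_mul_left h4 hkpos.le
    have h6 : |t - a| < ε := abs_lt_of_sq_lt_sq (by nlinarith [sq_nonneg ‖x - y‖]) hε.le
    have h7 : ‖x - y‖ < ε := by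
      have := abs_lt_of_sq_lt_sq (a := ‖x - y‖) (b := ε)
        (by nlinarith [sq_nonneg (t - a)]) hε.le
      simpa using this
    have htT : t ∈ Ico (0:ℝ) T := ⟨ht.1, by linarith [(abs_lt.1 h6).2]⟩
    have hr : (δ + T) / 2 ∈ Ico (0:ℝ) T := ⟨by linarith, by linarith⟩
    have hloc : IsLocalMaxOn
        (fun p : ℝ × ℝ × EuclideanSpace ℝ (Fin n) =>
          V p.1 p.2.1 p.2.2 - (quadTest n T δ k a y).φ p.1 p.2.1 p.2.2)
        (Dom n T) (t, (δ + T) / 2, x) := by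
      have ho : IsOpen {p : ℝ × ℝ × EuclideanSpace ℝ (Fin n) |
          |p.1 - a| < ε ∧ δ < p.2.1 ∧ ‖p.2.2 - y‖ < ε} :=
        IsOpen.and (isOpen_lt (by fun_prop) (by fun_prop))
          (IsOpen.and (isOpen_lt (by fun_prop) (by fun_prop))
            (isOpen_lt (by fun_prop) (by fun_prop)))
      have hmem := ho.mem_nhds (x := (t, (δ + T) / 2, x))
        ⟨h6, by show δ < (δ + T) / 2; linarith, h7⟩
      filter_upwards [mem_nhdsWithin_of_mem_nhds hmem, self_mem_nhdsWithin]
      rintro ⟨s, r, z⟩ ⟨hs1, hr1, hz1⟩ ⟨hs, hrI, -⟩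
      have e1 := hVflat s r z (le_of_lt hr1) hrI.2
      have e2 := hVflat t ((δ + T) / 2) x (by linarith) (by linarith)
      show V s r z - k * ((s - a) ^ 2 + ‖z - y‖ ^ 2)
        ≤ V t ((δ + T) / 2) x - k * ((t - a) ^ 2 + ‖x - y‖ ^ 2)
      rw [e1, e2]
      exact hmax' s z hs (le_of_lt hs1) (le_of_lt hz1)
    have hfin := (hsub.2 (quadTest n T δ k a y) t htT _ hr x hloc).trans (min_le_right _ _)
    rw [Nhat, if_pos (by linarith), hVflat t ((δ + T) / 2) x (by linarith) (by linarith)]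
      at hfin
    exact ⟨t, ht, x, h6.trans_le hεε', h7.trans_le hεε', by linarith⟩
  have main : ∀ ξ ∈ K, ∀ t ∈ Icc (0:ℝ) T, ∀ x : EuclideanSpace ℝ (Fin n),
      V t δ x ≤ V t 0 (x + ξ) + ℓ t ξ := by
    intro ξ hξ t ht x
    have hF : ContinuousOn (fun p : ℝ × EuclideanSpace ℝ (Fin n) =>
        V p.1 0 (p.2 + ξ) + ℓ p.1 ξ) (Icc (0:ℝ) T ×ˢ univ) := by
      refine ContinuousOn.add ?_ ?_
      · refine hVcont.comp
          (f := fun p : ℝ × EuclideanSpace ℝ (Fin n) => (p.1, (0:ℝ), p.2 + ξ))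
          (by fun_prop) ?_
        rintro ⟨t, x⟩ ⟨ht, -⟩
        exact ⟨ht, h0I, mem_univ _⟩
      · refine hℓcont.comp (f := fun p : ℝ × EuclideanSpace ℝ (Fin n) => (p.1, ξ))
          (by fun_prop) ?_
        rintro ⟨t, x⟩ ⟨ht, -⟩
        exact ⟨ht, hξ⟩
    set A : Set (ℝ × EuclideanSpace ℝ (Fin n)) :=
      {p | p ∈ Icc (0:ℝ) T ×ˢ (univ : Set (EuclideanSpace ℝ (Fin n))) ∧
        V p.1 δ p.2 ≤ V p.1 0 (p.2 + ξ) + ℓ p.1 ξ} with hA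
    have hAcl : IsClosed A :=
      IsClosed.isClosed_le (isClosed_Icc.prod isClosed_univ) hcδ hF
    have hcl : (t, x) ∈ closure A := by
      rw [Metric.mem_closure_iff]
      intro ε hε
      obtain ⟨a, ha, hat⟩ : ∃ a ∈ Ico (0:ℝ) T, |t - a| < ε / 2 := by
        rcases lt_or_eq_of_le ht.2 with h | h
        · exact ⟨t, ⟨ht.1, h⟩, by simpa using hε⟩
        · refine ⟨max 0 (T - ε / 4), ⟨le_max_left _ _, max_lt hT (by linarith)⟩, ?_⟩
          have e1 := le_max_right 0 (T - ε / 4)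
          have e2 : max 0 (T - ε / 4) ≤ T := max_le hT.le (by linarith)
          rw [abs_lt]
          constructor <;> linarith
      obtain ⟨s, hs, z, hsa, hzx, hle⟩ := key a ha x (ε / 2) (by linarith)
      refine ⟨(s, z), ⟨⟨hs, mem_univ _⟩, hle.trans (csInf_le (hbdd s hs z) ⟨ξ, hξ, rfl⟩)⟩, ?_⟩
      rw [Prod.dist_eq, max_lt_iff]
      constructor
      · have := dist_triangle t a s
        simp only [Real.dist_eq] at this ⊢
        rw [abs_sub_comm a s] at this
        linarith
      · show dist x z < ε
        rw [dist_comm, dist_eq_norm]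
        linarith
    exact (hAcl.closure_eq ▸ hcl : (t, x) ∈ A).2
  intro t ht r hr x
  rw [Nhat]
  split_ifs with hδr
  · rw [hVflat t r x hδr hr.2]
    obtain ⟨ξ₀, hξ₀⟩ := hKne
    refine le_csInf ⟨_, ξ₀, hξ₀, rfl⟩ ?_
    rintro y ⟨ξ, hξ, rfl⟩
    exact main ξ hξ t ht x
  · have := hVle t ht r hr x
    nlinarith
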